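/- Let X be a separable metrizable space that is not locally compact. Then basic(X) = 𝔠 = 2^ℵ0. -/

import Mathlib

open Cardinal Set Topology

noncomputable section

/-- A family `Φ ⊆ C(X)` is basic if every continuous real-valued function on `X`
is a finite sum of compositions `gᵢ ∘ φᵢ` with `φᵢ ∈ Φ` and `gᵢ ∈ C(ℝ)`. -/
def IsBasicFamily {X : Type u} [TopologicalSpace X] (Φ : Set C(X, ℝ)) : Prop :=
  ∀ f : C(X, ℝ), ∃ (m : ℕ) (φ : Fin m → C(X, ℝ)) (g : Fin m → C(ℝ, ℝ)),
    (∀ i, φ i ∈ Φ) ∧ ∀ x, f x = ∑ i, g i (φ i x)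

/-- `basic(X)`: the least cardinality of a basic family for `X`. -/
def basicCard (X : Type u) [TopologicalSpace X] : Cardinal.{u} :=
  sInf { c | ∃ Φ : Set C(X, ℝ), IsBasicFamily Φ ∧ #Φ = c }

/-- `dim X ≤ n`: every continuous map of a closed subspace of `X` into the
`n`-sphere extends continuously over `X`. -/
def DimLE (X : Type u) [TopologicalSpace X] (n : ℕ) : Prop :=
  ∀ A : Set X, IsClosed A →
    ∀ f : C(A, Metric.sphere (0 : EuclideanSpace ℝ (Fin (n + 1))) 1),
      ∃ F : C(X, Metric.sphere (0 : EuclideanSpace ℝ (Fin (n + 1))) 1),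
        ∀ a : A, F a = f a

/-- A Cantor set in `Y` is a subspace homeomorphic to the Cantor space `{0,1}^ℕ`. -/
def IsCantorSet {Y : Type u} [TopologicalSpace Y] (C : Set Y) : Prop :=
  Nonempty (C ≃ₜ (ℕ → Bool))

/-- Strong independence of a family `𝒞 ⊆ C(X)`. -/
def StronglyIndep {X : Type u} [TopologicalSpace X] (𝒞 : Set C(X, ℝ)) : Prop :=
  ∀ (n : ℕ) (φ : C(X, Fin n → ℝ)),
    #(𝒞 ∩ { f : C(X, ℝ) | ∃ g : C((Fin n → ℝ), ℝ), ∀ x, f x = g (φ x) } : Set C(X, ℝ)) ≤ n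

/-- Weak independence of a family `𝒞 ⊆ C(X)`. -/
def WeaklyIndep {X : Type u} [TopologicalSpace X] (𝒞 : Set C(X, ℝ)) : Prop :=
  ∀ (n : ℕ) (φ : Fin n → C(X, ℝ)),
    #(𝒞 ∩ { f : C(X, ℝ) | ∃ g : Fin n → C(ℝ, ℝ), ∀ x, f x = ∑ i, g i (φ i x) } : Set C(X, ℝ)) < 𝔠

/-- The weight of a topological space: least cardinality of a basis. -/
def weightCard (X : Type u) [TopologicalSpace X] : Cardinal.{u} :=
  sInf { c | ∃ B : Set (Set X), TopologicalSpace.IsTopologicalBasis B ∧ #B = c }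

/-- `cof([κ]^{ℵ₀}, ⊆)`: least cardinality of a family of countably infinite subsets
of (a set of size) `κ` which is cofinal in the countably infinite subsets. -/
def cofCtblSubsets (κ : Cardinal.{u}) : Cardinal.{u} :=
  sInf { c | ∃ 𝒞 : Set (Set κ.out),
    (∀ C ∈ 𝒞, C.Countable ∧ C.Infinite) ∧
    (∀ S : Set κ.out, S.Countable → S.Infinite → ∃ C ∈ 𝒞, S ⊆ C) ∧ #𝒞 = c }


/-- A weighted series whose first nonzero coefficient has absolute value at least `1`
is bounded away from zero. -/
lemma half_pow_le_abs_tsum {d : ℕ → ℝ} {N : ℕ} (hd : ∀ n, |d n| ≤ 1)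
    (hlt : ∀ n < N, d n = 0) (hN : 1 ≤ |d N|) :
    (1 / 3 : ℝ) ^ N / 2 ≤ |∑' n, (1 / 3 : ℝ) ^ n * d n| := by
  have hgeom : Summable fun n : ℕ => (1 / 3 : ℝ) ^ n :=
    summable_geometric_of_lt_one (by norm_num) (by norm_num)
  have hbound : ∀ n, ‖(1 / 3 : ℝ) ^ n * d n‖ ≤ (1 / 3 : ℝ) ^ n := fun n => by
    rw [norm_mul, Real.norm_eq_abs, Real.norm_eq_abs, abs_of_pos (by positivity : (0 : ℝ) < (1 / 3) ^ n)]
    exact mul_le_of_le_one_right (by positivity) (hd n)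
  have hsum : Summable fun n => (1 / 3 : ℝ) ^ n * d n := hgeom.of_norm_bounded hbound
  have hsplit := hsum.sum_add_tsum_nat_add (N + 1)
  rw [Finset.sum_range_succ, Finset.sum_eq_zero fun n hn => by
    rw [hlt n (Finset.mem_range.1 hn), mul_zero], zero_add] at hsplit
  have htail : ‖∑' n, (1 / 3 : ℝ) ^ (n + (N + 1)) * d (n + (N + 1))‖ ≤ (1 / 3 : ℝ) ^ N / 2 := by
    have hs : HasSum (fun n : ℕ => (1 / 3 : ℝ) ^ (n + (N + 1))) ((1 / 3 : ℝ) ^ N / 2) := by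
      have := (hasSum_geometric_of_lt_one (r := (1 / 3 : ℝ)) (by norm_num) (by norm_num)).mul_right
        ((1 / 3 : ℝ) ^ (N + 1))
      simp only [← pow_add] at this
      rwa [show (1 - 1 / 3 : ℝ)⁻¹ * (1 / 3) ^ (N + 1) = (1 / 3) ^ N / 2 by
        rw [pow_succ]; ring] at this
    exact tsum_of_norm_bounded hs fun n => hbound _
  have hhead : (1 / 3 : ℝ) ^ N ≤ |(1 / 3 : ℝ) ^ N * d N| := by
    rw [abs_mul, abs_of_pos (by positivity : (0 : ℝ) < (1 / 3) ^ N)]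
    exact le_mul_of_one_le_right (by positivity) hN
  rw [← hsplit]
  rw [Real.norm_eq_abs] at htail
  have := abs_sub_abs_le_abs_add ((1 / 3 : ℝ) ^ N * d N)
    (∑' n, (1 / 3 : ℝ) ^ (n + (N + 1)) * d (n + (N + 1)))
  linarith

/-- A noncompact closed subset of a metric space contains an infinite set all of whose subsets
are closed. -/
lemma exists_infinite_forall_subset_isClosed {X : Type*} [MetricSpace X] {K : Set X}
    (hK : IsClosed K) (hKc : ¬ IsCompact K) :
    ∃ T ⊆ K, T.Infinite ∧ ∀ S ⊆ T, IsClosed S := by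
  rw [isCompact_iff_isSeqCompact, IsSeqCompact] at hKc
  push Not at hKc
  obtain ⟨u, huK, hu⟩ := hKc
  have hlim : ∀ a, ∀ ψ : ℕ → ℕ, StrictMono ψ → ¬ Filter.Tendsto (u ∘ ψ) Filter.atTop (𝓝 a) :=
    fun a ψ hψ ht =>
      hu a (hK.mem_of_tendsto ht (Filter.Eventually.of_forall fun n => huK _)) ψ hψ ht
  have hfin : LocallyFinite fun k => ({u k} : Set X) := by
    intro x
    have hx : ¬ MapClusterPt x Filter.atTop u := fun hc => by
      obtain ⟨ψ, hψ, ht⟩ := hc.tendsto_subseq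
      exact hlim x ψ hψ ht
    rw [mapClusterPt_iff_frequently] at hx
    push Not at hx
    obtain ⟨V, hV, hV'⟩ := hx
    refine ⟨V, hV, ?_⟩
    rw [← Nat.cofinite_eq_atTop, Filter.eventually_cofinite] at hV'
    refine hV'.subset fun k hk => ?_
    simpa using hk
  refine ⟨range u, range_subset_iff.2 huK, fun hr => ?_, fun S hS => ?_⟩
  · obtain ⟨a, -, ψ, hψ, ht⟩ := hr.isCompact.tendsto_subseq fun n => mem_range_self n
    exact hlim a ψ hψ ht
  · have hSu : S = ⋃ k : u ⁻¹' S, {u k} := by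
      ext x
      simp only [mem_iUnion, mem_singleton_iff]
      constructor
      · intro hx
        obtain ⟨k, rfl⟩ := hS hx
        exact ⟨⟨k, hx⟩, rfl⟩
      · rintro ⟨k, rfl⟩
        exact k.2
    rw [hSu]
    exact (hfin.comp_injective Subtype.val_injective).isClosed_iUnion fun _ => isClosed_singleton

/-- On a noncompact closed ball there is a `1`-separated family of continuous functions, indexed
by the sets of natural numbers, which all vanish on a smaller ball. -/
lemma exists_separated_family_closedBall {X : Type*} [MetricSpace X] {p : X} {r : ℝ} (hr : 0 < r)
    (hc : ¬ IsCompact (Metric.closedBall p r)) :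
    ∃ r' : ℝ, 0 < r' ∧ r' ≤ r / 2 ∧ ∃ h : Set ℕ → C(X, ℝ),
      (∀ A x, h A x ∈ Icc (0 : ℝ) 1) ∧ (∀ A, ∀ x ∈ Metric.closedBall p r', h A x = 0) ∧
      ∀ A B, A ≠ B → ∃ x ∈ Metric.closedBall p r, 1 ≤ |h A x - h B x| := by
  obtain ⟨T, hTK, hT, hTc⟩ :=
    exists_infinite_forall_subset_isClosed Metric.isClosed_closedBall hc
  have hT' : (T \ {p}).Infinite := hT.sdiff (finite_singleton p)
  let e := hT'.natEmbedding
  have hclosed : ∀ A : Set ℕ, IsClosed ((fun n => (e n : X)) '' A) := fun A =>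
    hTc _ (image_subset_iff.2 fun n _ => (e n).2.1)
  have hinj : Function.Injective fun n => (e n : X) := Subtype.val_injective.comp e.injective
  have hnear : (T \ {p})ᶜ ∈ 𝓝 p := (hTc _ sdiff_subset).isOpen_compl.mem_nhds (by simp)
  obtain ⟨ε, hε, hεT⟩ := Metric.nhds_basis_closedBall.mem_iff.1 hnear
  refine ⟨min ε (r / 2), by positivity, min_le_right _ _, ?_⟩
  have hex : ∀ A : Set ℕ, ∃ h : C(X, ℝ), EqOn h 0
      ((fun n => (e n : X)) '' Aᶜ ∪ Metric.closedBall p (min ε (r / 2))) ∧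
      EqOn h 1 ((fun n => (e n : X)) '' A) ∧ ∀ x, h x ∈ Icc (0 : ℝ) 1 := fun A => by
    refine exists_continuous_zero_one_of_isClosed
      ((hclosed _).union Metric.isClosed_closedBall) (hclosed A) ?_
    rw [disjoint_union_left]
    refine ⟨(disjoint_image_iff hinj).2 disjoint_compl_left, ?_⟩
    rw [Set.disjoint_left]
    rintro x hx ⟨n, -, rfl⟩
    exact hεT (Metric.closedBall_subset_closedBall (min_le_left _ _) hx) (e n).2
  choose h h0 h1 hI using hex
  refine ⟨h, hI, fun A x hx => h0 A (Or.inr hx), fun A B hAB => ?_⟩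
  obtain ⟨n, hn⟩ : ∃ n, ¬ (n ∈ A ↔ n ∈ B) := by
    by_contra! hall
    exact hAB (Set.ext hall)
  refine ⟨e n, hTK (e n).2.1, ?_⟩
  have hmem : ∀ C, n ∈ C → h C (e n) = 1 := fun C hC => h1 C ⟨n, hC, rfl⟩
  have hnot : ∀ C, n ∉ C → h C (e n) = 0 := fun C hC => h0 C (Or.inl ⟨n, hC, rfl⟩)
  by_cases hA : n ∈ A <;> by_cases hB : n ∈ B
  · tauto
  · rw [hmem A hA, hnot B hB]; norm_num
  · rw [hnot A hA, hmem B hB]; norm_num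
  · tauto

/-- At a point without compact neighborhoods there is a family of continuous functions, indexed
by the sets of natural numbers, which is uniformly separated on every ball around the point. -/
lemma exists_separated_family {X : Type*} [MetricSpace X] {p : X}
    (hc : ∀ r > 0, ¬ IsCompact (Metric.closedBall p r)) :
    ∃ f : Set ℕ → C(X, ℝ), ∀ ε > 0, ∃ δ > 0, ∀ A B, A ≠ B →
      ∃ x ∈ Metric.closedBall p ε, δ ≤ |f A x - f B x| := by
  have hstep : ∀ r : {r : ℝ // 0 < r}, ∃ r' : {r : ℝ // 0 < r}, r'.1 ≤ r.1 / 2 ∧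
      ∃ h : Set ℕ → C(X, ℝ),
      (∀ A x, h A x ∈ Icc (0 : ℝ) 1) ∧ (∀ A, ∀ x ∈ Metric.closedBall p r'.1, h A x = 0) ∧
      ∀ A B, A ≠ B → ∃ x ∈ Metric.closedBall p r.1, 1 ≤ |h A x - h B x| := fun r => by
    obtain ⟨r', h0, h1, h2⟩ := exists_separated_family_closedBall r.2 (hc r.1 r.2)
    exact ⟨⟨r', h0⟩, h1, h2⟩
  choose ρ hρ H hI hzero hsep using hstep
  let r : ℕ → {r : ℝ // 0 < r} := fun n => ρ^[n] ⟨1, one_pos⟩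
  have hr : ∀ n, r (n + 1) = ρ (r n) := fun n => Function.iterate_succ_apply' ρ n _
  have hanti : Antitone fun n => (r n).1 := antitone_nat_of_succ_le fun n => by
    rw [hr]
    linarith [hρ (r n), (r n).2]
  have hsmall : ∀ n, (r n).1 ≤ (1 / 2 : ℝ) ^ n := fun n => by
    induction n with
    | zero => simp [r]
    | succ n ih =>
      rw [hr, pow_succ]
      linarith [hρ (r n)]
  have hgeom : Summable fun n : ℕ => (1 / 3 : ℝ) ^ n :=
    summable_geometric_of_lt_one (by norm_num) (by norm_num)
  have hbound : ∀ A n x, ‖(1 / 3 : ℝ) ^ n * H (r n) A x‖ ≤ (1 / 3 : ℝ) ^ n := fun A n x => by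
    obtain ⟨h0, h1⟩ := hI (r n) A x
    rw [Real.norm_eq_abs, abs_of_nonneg (by positivity)]
    exact mul_le_of_le_one_right (by positivity) h1
  refine ⟨fun A => ⟨fun x => ∑' n, (1 / 3 : ℝ) ^ n * H (r n) A x,
    continuous_tsum (fun n => by fun_prop) hgeom (hbound A)⟩, fun ε hε => ?_⟩
  obtain ⟨N, hN⟩ := exists_pow_lt_of_lt_one hε (by norm_num : (1 / 2 : ℝ) < 1)
  refine ⟨(1 / 3 : ℝ) ^ N / 2, by positivity, fun A B hAB => ?_⟩
  obtain ⟨x, hx, hx1⟩ := hsep (r N) A B hAB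
  refine ⟨x, Metric.closedBall_subset_closedBall ((hsmall N).trans hN.le) hx, ?_⟩
  have hsub : (∑' n, (1 / 3 : ℝ) ^ n * H (r n) A x) - (∑' n, (1 / 3 : ℝ) ^ n * H (r n) B x) =
      ∑' n, (1 / 3 : ℝ) ^ n * (H (r n) A x - H (r n) B x) := by
    rw [← (hgeom.of_norm_bounded (hbound A · x)).tsum_sub
      (hgeom.of_norm_bounded (hbound B · x))]
    simp only [mul_sub]
  simp only [ContinuousMap.coe_mk]
  rw [hsub]
  refine half_pow_le_abs_tsum (fun n => ?_) (fun n hn => ?_) hx1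
  · obtain ⟨hA0, hA1⟩ := hI (r n) A x
    obtain ⟨hB0, hB1⟩ := hI (r n) B x
    rw [abs_le]
    constructor <;> linarith
  · have hxn : x ∈ Metric.closedBall p (ρ (r n)).1 := by
      rw [← hr]
      exact Metric.closedBall_subset_closedBall (hanti hn) hx
    rw [hzero _ A x hxn, hzero _ B x hxn, sub_zero]

/-- Only countably many members of a family that is uniformly separated near `p` are sums of
compositions with a fixed finite tuple of continuous functions. -/
lemma countable_setOf_eq_sum_comp {X ι : Type*} [MetricSpace X] {p : X} {f : ι → C(X, ℝ)}
    (hf : ∀ ε > 0, ∃ δ > 0, ∀ A B, A ≠ B →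
      ∃ x ∈ Metric.closedBall p ε, δ ≤ |f A x - f B x|)
    {m : ℕ} (φ : Fin m → C(X, ℝ)) :
    {A | ∃ g : Fin m → C(ℝ, ℝ), ∀ x, f A x = ∑ i, g i (φ i x)}.Countable := by
  set S := {A | ∃ g : Fin m → C(ℝ, ℝ), ∀ x, f A x = ∑ i, g i (φ i x)} with hS
  obtain ⟨ε, hε, hεφ⟩ : ∃ ε > 0, ∀ x ∈ Metric.closedBall p ε, ∀ i,
      φ i x ∈ Metric.closedBall (φ i p) 1 := by
    have : ∀ᶠ x in 𝓝 p, ∀ i, φ i x ∈ Metric.closedBall (φ i p) 1 :=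
      Filter.eventually_all.2 fun i =>
        (φ i).continuous.continuousAt.eventually_mem (Metric.closedBall_mem_nhds _ one_pos)
    exact Metric.nhds_basis_closedBall.mem_iff.1 this
  obtain ⟨δ, hδ, hsep⟩ := hf ε hε
  choose! g hg using fun A (hA : A ∈ S) => hA
  let G : ι → ∀ i : Fin m, C(Metric.closedBall (φ i p) 1, ℝ) := fun A i =>
    (g A i).restrict (Metric.closedBall (φ i p) 1)
  set η : ℝ := δ / (2 * (m + 1)) with hη
  have hη0 : 0 < η := by positivity
  have hdisj : S.PairwiseDisjoint fun A => Metric.ball (G A) η := by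
    intro A hA B hB hAB
    refine Set.disjoint_left.2 fun w hwA hwB => ?_
    obtain ⟨x, hx, hxδ⟩ := hsep A B hAB
    have hdist : dist (G A) (G B) ≤ 2 * η := by
      have := dist_triangle_right (G A) (G B) w
      rw [Metric.mem_ball'] at hwA hwB
      linarith
    have hi : ∀ i, |g A i (φ i x) - g B i (φ i x)| ≤ 2 * η := fun i =>
      (ContinuousMap.dist_apply_le_dist (f := G A i) (g := G B i)
        ⟨φ i x, hεφ x hx i⟩).trans ((dist_le_pi_dist _ _ i).trans hdist)
    have hle : |f A x - f B x| ≤ m * (2 * η) := by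
      rw [hg A hA x, hg B hB x, ← Finset.sum_sub_distrib]
      refine (Finset.abs_sum_le_sum_abs _ _).trans ((Finset.sum_le_sum fun i _ => hi i).trans ?_)
      simp
    have hlt : m * (2 * η) < δ := by
      rw [hη]
      field_simp
      linarith
    linarith
  exact hdisj.countable_of_isOpen (fun _ _ => Metric.isOpen_ball)
    fun _ _ => Metric.nonempty_ball.2 hη0

/-- Every basic family for a metric space has at least continuum many members if some point has
no compact neighborhood. -/
lemma continuum_le_mk_of_isBasicFamily {X : Type u} [MetricSpace X] {p : X}
    (hc : ∀ r > 0, ¬ IsCompact (Metric.closedBall p r)) {Φ : Set C(X, ℝ)}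
    (hΦ : IsBasicFamily Φ) : 𝔠 ≤ #Φ := by
  obtain ⟨f, hf⟩ := exists_separated_family hc
  have htuple : ∀ A : ULift.{u} (Set ℕ), ∃ l : Σ m, Fin m → Φ, ∃ g : Fin l.1 → C(ℝ, ℝ),
      ∀ x, f A.down x = ∑ i, g i ((l.2 i).1 x) := fun A => by
    obtain ⟨m, φ, g, hφ, h⟩ := hΦ (f A.down)
    exact ⟨⟨m, fun i => ⟨φ i, hφ i⟩⟩, g, h⟩
  choose L hL using htuple
  have hfiber : ∀ l, #(L ⁻¹' {l}) ≤ ℵ₀ := fun l => by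
    rw [Cardinal.le_aleph0_iff_set_countable]
    refine ((countable_setOf_eq_sum_comp hf fun i => (l.2 i).1).preimage
      ULift.down_injective).mono ?_
    rintro A rfl
    exact hL A
  have hle := Cardinal.mk_le_mk_mul_of_mk_preimage_le L hfiber
  rw [← Cardinal.mk_congr (List.equivSigmaTuple (α := Φ)), Cardinal.mk_uLift, Cardinal.mk_set,
    Cardinal.mk_nat, Cardinal.two_power_aleph0, Cardinal.lift_continuum] at hle
  have hmax : #(List Φ) * ℵ₀ ≤ max ℵ₀ #Φ :=
    (mul_le_mul' (Cardinal.mk_list_le_max Φ) (le_max_left ℵ₀ #Φ)).trans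
      (Cardinal.mul_eq_self (le_max_left _ _)).le
  exact (le_max_iff.1 (hle.trans hmax)).resolve_left Cardinal.aleph0_lt_continuum.not_ge

/-- A separable space has at most continuum many continuous real-valued functions. -/
lemma mk_continuousMap_real_le_continuum (X : Type u) [TopologicalSpace X]
    [TopologicalSpace.SeparableSpace X] : #C(X, ℝ) ≤ 𝔠 := by
  obtain ⟨D, hDc, hD⟩ := TopologicalSpace.exists_countable_dense X
  have hinj : Function.Injective fun (f : C(X, ℝ)) (d : D) => f d := fun f g hfg =>
    ContinuousMap.coe_injective <| Continuous.ext_on hD f.continuous g.continuous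
      fun d hd => congrFun hfg ⟨d, hd⟩
  refine (Cardinal.mk_le_of_injective hinj).trans ?_
  have hD0 : #D ≤ ℵ₀ := Cardinal.le_aleph0_iff_set_countable.2 hDc
  simp only [Cardinal.mk_pi, Cardinal.mk_real, Cardinal.prod_const, Cardinal.lift_continuum]
  calc (𝔠 : Cardinal.{u}) ^ Cardinal.lift.{0} #D ≤ 𝔠 ^ ℵ₀ :=
        Cardinal.power_le_power_left Cardinal.continuum_ne_zero (by simpa using hD0)
    _ = 𝔠 := Cardinal.continuum_power_aleph0

/-- The family of all continuous functions is basic. -/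
lemma isBasicFamily_univ (X : Type u) [TopologicalSpace X] :
    IsBasicFamily (univ : Set C(X, ℝ)) := fun f =>
  ⟨1, fun _ => f, fun _ => ContinuousMap.id ℝ, fun _ => mem_univ _, fun x => by simp⟩

theorem stmt18 (X : Type u) [TopologicalSpace X] [TopologicalSpace.MetrizableSpace X]
    [TopologicalSpace.SeparableSpace X] (h : ¬ LocallyCompactSpace X) :
    basicCard X = 𝔠 := by
  let _ := TopologicalSpace.metrizableSpaceMetric X
  obtain ⟨p, hp⟩ : ∃ p : X, ∀ r > 0, ¬ IsCompact (Metric.closedBall p r) := by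
    by_contra! hcon
    have : WeaklyLocallyCompactSpace X := ⟨fun x => by
      obtain ⟨r, hr, hc⟩ := hcon x
      exact ⟨_, hc, Metric.closedBall_mem_nhds x hr⟩⟩
    exact h inferInstance
  unfold basicCard
  apply le_antisymm
  · apply (csInf_le' (by exact ⟨univ, isBasicFamily_univ X, rfl⟩)).trans
    rw [Cardinal.mk_univ]
    exact mk_continuousMap_real_le_continuum X
  · refine le_csInf ⟨_, univ, isBasicFamily_univ X, rfl⟩ ?_
    rintro _ ⟨Φ, hΦ, rfl⟩
    exact continuum_le_mk_of_isBasicFamily hp hΦ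

end
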